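/- Let n, d be positive integers, let Ω ⊂ ℝ^n be a bounded open set, let K > 0, and let f : ℝ^d → ℝ be a convex function satisfying K^{-1}|b| ≤ f(b) ≤ K(1 + |b|) for all b ∈ ℝ^d. Let f^∞ : ℝ^d → ℝ be a function such that f^∞(b) = lim_{t→∞} f(tb)/t for every b ∈ ℝ^d. Let (v_k) be a sequence in L¹(Ω;ℝ^d) such that ℒ^n({x ∈ Ω : v_k(x) ≠ 0}) → 0 as k → ∞. Then liminf_{k→∞} ∫_{{x : v_k(x) ≠ 0}} f(v_k(x)) dx ≥ liminf_{k→∞} ∫_Ω f^∞(v_k(x)) dx. -/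

import Mathlib

open MeasureTheory Filter Topology Set
open scoped ENNReal

/-- Comparison of real lower limits up to a vanishing error and a factor arbitrarily close to
one. The a priori bound `hBA` makes the junk value of an infinite lower limit harmless. -/
theorem liminf_le_liminf_of_le_one_add_mul {A B s : ℕ → ℝ} {c : ℝ} (hc : 0 < c)
    (hs : Tendsto s atTop (𝓝 0)) (hA : ∀ k, 0 ≤ A k) (hB : ∀ k, 0 ≤ B k)
    (hBA : ∀ k, B k ≤ c * (s k + A k))
    (hAB : ∀ ε > 0, ∃ C : ℝ, ∀ k, A k ≤ (1 + ε) * B k + C * s k) :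
    liminf A atTop ≤ liminf B atTop := by
  rw [liminf_eq, liminf_eq]
  have hB0 : (0 : ℝ) ∈ {a | ∀ᶠ k in atTop, a ≤ B k} := Eventually.of_forall hB
  by_cases hbdd : BddAbove {a | ∀ᶠ k in atTop, a ≤ A k}
  swap
  · rw [Real.sSup_of_not_bddAbove hbdd]
    exact Real.sSup_nonneg' ⟨0, hB0, le_rfl⟩
  have hbddB : BddAbove {a | ∀ᶠ k in atTop, a ≤ B k} := by
    obtain ⟨M, hM⟩ := hbdd
    refine ⟨c * (1 + M), fun a ha => ?_⟩
    have h : a / c - 1 ≤ M := by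
      apply hM
      filter_upwards [ha, hs.eventually (gt_mem_nhds one_pos)] with k hk hk1
      have : a / c ≤ s k + A k := by
        rw [div_le_iff₀' hc]
        exact hk.trans (hBA k)
      linarith
    rw [← div_le_iff₀' hc]
    linarith
  refine csSup_le ⟨0, Eventually.of_forall hA⟩ fun a ha => ?_
  set β := sSup {a | ∀ᶠ k in atTop, a ≤ B k}
  have key : ∀ ε > 0, a ≤ (1 + ε) * β + ε := by
    intro ε hε
    obtain ⟨C, hC⟩ := hAB ε hε
    have hCs : Tendsto (fun k => C * s k) atTop (𝓝 0) := by simpa using hs.const_mul C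
    have h1 : (a - ε) / (1 + ε) ≤ β := by
      apply le_csSup hbddB
      filter_upwards [ha, hCs.eventually (gt_mem_nhds hε)] with k hk hk1
      rw [div_le_iff₀' (by linarith)]
      linarith [hC k]
    rw [div_le_iff₀' (by linarith)] at h1
    linarith
  have hT : Tendsto (fun ε : ℝ => (1 + ε) * β + ε) (𝓝[>] 0) (𝓝 β) := by
    have : Continuous fun ε : ℝ => (1 + ε) * β + ε := by fun_prop
    simpa using (this.tendsto 0).mono_left nhdsWithin_le_nhds
  exact ge_of_tendsto hT (by filter_upwards [self_mem_nhdsWithin] with ε hε using key ε hε)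

theorem continuous_of_sub_le_mul_norm {E : Type*} [NormedAddCommGroup E] {g : E → ℝ} {K : ℝ}
    (hK : 0 ≤ K)
    (hg : ∀ x y, g y - g x ≤ K * ‖y - x‖) : Continuous g := by
  refine (LipschitzWith.of_le_add_mul K.toNNReal fun x y => ?_).continuous
  rw [Real.coe_toNNReal K hK, dist_eq_norm]
  linarith [hg y x]

section Recession

variable {E : Type*} [NormedAddCommGroup E] [NormedSpace ℝ E] {f finf : E → ℝ} {K : ℝ}

/-- A convex function of at most linear growth is Lipschitz. -/
theorem ConvexOn.sub_le_mul_norm_of_linear_growth (hK : 0 ≤ K)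
    (hconv : ConvexOn ℝ univ f) (hupper : ∀ b, f b ≤ K * (1 + ‖b‖)) (x y : E) :
    f y - f x ≤ K * ‖y - x‖ := by
  have hbound : ∀ t : ℝ, 1 ≤ t →
      f y - f x ≤ (K * (1 + ‖x‖) - f x) / t + K * ‖y - x‖ := by
    intro t ht
    have ht0 : 0 < t := by linarith
    have hy : (1 - t⁻¹) • x + t⁻¹ • (x + t • (y - x)) = y := by
      rw [smul_add, smul_smul, inv_mul_cancel₀ ht0.ne']
      module
    have h1 := hconv.2 (mem_univ x) (mem_univ (x + t • (y - x)))
      (sub_nonneg.2 (inv_le_one_of_one_le₀ ht)) (inv_nonneg.2 ht0.le) (by ring)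
    rw [hy, smul_eq_mul, smul_eq_mul] at h1
    have h2 : f (x + t • (y - x)) ≤ K * (1 + ‖x‖ + t * ‖y - x‖) := by
      refine (hupper _).trans (mul_le_mul_of_nonneg_left ?_ hK)
      have := norm_add_le x (t • (y - x))
      rw [norm_smul, Real.norm_of_nonneg ht0.le] at this
      linarith
    have h3 := mul_le_mul_of_nonneg_left h2 (inv_nonneg.2 ht0.le)
    have h4 : t⁻¹ * (K * (1 + ‖x‖ + t * ‖y - x‖))
        = t⁻¹ * (K * (1 + ‖x‖)) + K * ‖y - x‖ := by
      field_simp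
    rw [div_eq_inv_mul]
    linarith
  have hT : Tendsto (fun t : ℝ => (K * (1 + ‖x‖) - f x) / t + K * ‖y - x‖) atTop
      (𝓝 (0 + K * ‖y - x‖)) :=
    (tendsto_const_nhds.div_atTop tendsto_id).add_const _
  rw [zero_add] at hT
  exact ge_of_tendsto hT (by filter_upwards [eventually_ge_atTop 1] with t ht using hbound t ht)

theorem recession_smul
    (hlim : ∀ b, Tendsto (fun t : ℝ => f (t • b) / t) atTop (𝓝 (finf b)))
    {r : ℝ} (hr : 0 < r) (b : E) : finf (r • b) = r * finf b := by
  refine tendsto_nhds_unique (hlim (r • b)) ?_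
  have h := ((hlim b).comp (tendsto_id.atTop_mul_const hr)).const_mul r
  refine h.congr fun t => ?_
  simp only [Function.comp, id, smul_smul]
  field_simp

theorem recession_sub_le (hK : 0 ≤ K)
    (hconv : ConvexOn ℝ univ f) (hupper : ∀ b, f b ≤ K * (1 + ‖b‖))
    (hlim : ∀ b, Tendsto (fun t : ℝ => f (t • b) / t) atTop (𝓝 (finf b))) (x y : E) :
    finf y - finf x ≤ K * ‖y - x‖ := by
  refine le_of_tendsto ((hlim y).sub (hlim x)) ?_
  filter_upwards [eventually_gt_atTop 0] with t ht
  have h := hconv.sub_le_mul_norm_of_linear_growth hK hupper (t • x) (t • y)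
  rw [← smul_sub, norm_smul, Real.norm_of_nonneg ht.le] at h
  rw [← sub_div, div_le_iff₀ ht]
  linarith

theorem recession_zero
    (hlim : ∀ b, Tendsto (fun t : ℝ => f (t • b) / t) atTop (𝓝 (finf b))) : finf 0 = 0 := by
  have := recession_smul hlim two_pos 0
  rw [smul_zero] at this
  linarith

theorem mul_norm_le_recession {c : ℝ} (hlower : ∀ b, c * ‖b‖ ≤ f b)
    (hlim : ∀ b, Tendsto (fun t : ℝ => f (t • b) / t) atTop (𝓝 (finf b))) (b : E) :
    c * ‖b‖ ≤ finf b := by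
  refine ge_of_tendsto (hlim b) ?_
  filter_upwards [eventually_gt_atTop 0] with t ht
  have h := hlower (t • b)
  rw [norm_smul, Real.norm_of_nonneg ht.le] at h
  rw [le_div_iff₀ ht]
  linarith

/-- The convergence to the recession function is uniform on the unit sphere, so that the
recession function exceeds the function by at most an arbitrarily small linear term. -/
theorem recession_le_add_mul_norm [ProperSpace E] (hK : 0 < K)
    (hconv : ConvexOn ℝ univ f) (hnonneg : ∀ b, 0 ≤ f b) (hupper : ∀ b, f b ≤ K * (1 + ‖b‖))
    (hlim : ∀ b, Tendsto (fun t : ℝ => f (t • b) / t) atTop (𝓝 (finf b)))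
    {ε : ℝ} (hε : 0 < ε) : ∃ C : ℝ, ∀ b, finf b ≤ f b + ε * ‖b‖ + C := by
  obtain ⟨N, -, hNfin, hN⟩ := (isCompact_sphere (0 : E) 1).finite_cover_balls
    (e := ε / (4 * K)) (by positivity)
  have hev : ∀ᶠ t : ℝ in atTop, ∀ z ∈ N, finf z - ε / 2 < f (t • z) / t :=
    (eventually_all_finite hNfin).2 fun z _ => (hlim z).eventually (lt_mem_nhds (by linarith))
  obtain ⟨T, hT⟩ := eventually_atTop.1 hev
  refine ⟨K * |T|, fun b => ?_⟩
  rcases le_or_gt ‖b‖ |T| with hb | hb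
  · have h1 := recession_sub_le hK.le hconv hupper hlim 0 b
    rw [recession_zero hlim, sub_zero, sub_zero] at h1
    have h2 := mul_le_mul_of_nonneg_left hb hK.le
    have h3 : 0 ≤ ε * ‖b‖ := by positivity
    linarith [hnonneg b]
  · have hb0 : 0 < ‖b‖ := (abs_nonneg T).trans_lt hb
    set w : E := ‖b‖⁻¹ • b with hw
    have hbw : ‖b‖ • w = b := by rw [hw, smul_smul, mul_inv_cancel₀ hb0.ne', one_smul]
    have hws : w ∈ Metric.sphere (0 : E) 1 := by
      rw [mem_sphere_zero_iff_norm, hw, norm_smul, norm_inv, norm_norm, inv_mul_cancel₀ hb0.ne']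
    obtain ⟨z, hz, hwz⟩ := mem_iUnion₂.1 (hN hws)
    rw [Metric.mem_ball, dist_eq_norm, lt_div_iff₀ (by positivity)] at hwz
    have h1 := hT ‖b‖ ((le_abs_self T).trans hb.le) z hz
    rw [lt_div_iff₀ hb0] at h1
    have h2 := recession_sub_le hK.le hconv hupper hlim z w
    have h3 := hconv.sub_le_mul_norm_of_linear_growth hK.le hupper b (‖b‖ • z)
    have h4 : ‖b‖ • z - b = ‖b‖ • (z - w) := by rw [smul_sub, hbw]
    rw [h4, norm_smul, norm_norm, norm_sub_rev] at h3
    have h5 : finf b = ‖b‖ * finf w := by rw [← recession_smul hlim hb0, hbw]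
    have h6 : 0 ≤ K * |T| := by positivity
    have h7 := mul_le_mul_of_nonneg_left h2 hb0.le
    have h8 := mul_le_mul_of_nonneg_left hwz.le hb0.le
    linarith

end Recession

/-- Along a purely concentrating sequence, the liminf of the energy with density `f` dominates
the liminf of the energy with the recession function `f^∞`. -/
theorem liminf_concentrating_ge_recession
    (n d : ℕ) (hn : 0 < n) (hd : 0 < d)
    (Ω : Set (EuclideanSpace ℝ (Fin n))) (hΩo : IsOpen Ω) (hΩb : Bornology.IsBounded Ω)
    (K : ℝ) (hK : 0 < K)
    (f : EuclideanSpace ℝ (Fin d) → ℝ) (hconv : ConvexOn ℝ Set.univ f)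
    (hlower : ∀ b, K⁻¹ * ‖b‖ ≤ f b) (hupper : ∀ b, f b ≤ K * (1 + ‖b‖))
    (finf : EuclideanSpace ℝ (Fin d) → ℝ)
    (hlim : ∀ b, Filter.Tendsto (fun t : ℝ => f (t • b) / t) Filter.atTop (𝓝 (finf b)))
    (v : ℕ → EuclideanSpace ℝ (Fin n) → EuclideanSpace ℝ (Fin d))
    (hint : ∀ k, IntegrableOn (v k) Ω volume)
    (hconc : Tendsto (fun k => volume {x ∈ Ω | v k x ≠ 0}) atTop (𝓝 0)) :
    Filter.liminf (fun k => ∫ x in Ω, finf (v k x)) Filter.atTop ≤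
      Filter.liminf (fun k => ∫ x in {x ∈ Ω | v k x ≠ 0}, f (v k x)) Filter.atTop := by
  have hnonneg : ∀ b, 0 ≤ f b := fun b => le_trans (by positivity) (hlower b)
  have hlow : ∀ b, K⁻¹ * ‖b‖ ≤ finf b := mul_norm_le_recession hlower hlim
  have hinf_nonneg : ∀ b, 0 ≤ finf b := fun b => le_trans (by positivity) (hlow b)
  have hinf0 : finf 0 = 0 := recession_zero hlim
  have hfc : Continuous f :=
    continuous_of_sub_le_mul_norm hK.le (hconv.sub_le_mul_norm_of_linear_growth hK.le hupper)
  have hinfc : Continuous finf :=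
    continuous_of_sub_le_mul_norm hK.le (recession_sub_le hK.le hconv hupper hlim)
  have hΩfin : IsFiniteMeasure (volume.restrict Ω) :=
    isFiniteMeasure_restrict.2 hΩb.measure_lt_top.ne
  have hfint : ∀ k, Integrable (fun x => f (v k x)) (volume.restrict Ω) := fun k => by
    refine (((integrable_const (1 : ℝ)).add (hint k).norm).const_mul K).mono'
      (hfc.comp_aestronglyMeasurable (hint k).1) (Eventually.of_forall fun x => ?_)
    rw [Real.norm_of_nonneg (hnonneg _)]
    exact hupper _
  have hinfint : ∀ k, Integrable (fun x => finf (v k x)) (volume.restrict Ω) := fun k => by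
    refine ((hint k).norm.const_mul K).mono'
      (hinfc.comp_aestronglyMeasurable (hint k).1) (Eventually.of_forall fun x => ?_)
    rw [Real.norm_of_nonneg (hinf_nonneg _)]
    have := recession_sub_le hK.le hconv hupper hlim 0 (v k x)
    rwa [hinf0, sub_zero, sub_zero] at this
  set S : ℕ → Set (EuclideanSpace ℝ (Fin n)) := fun k => {x ∈ Ω | v k x ≠ 0}
  have hSΩ : ∀ k, S k ⊆ Ω := fun k x hx => hx.1
  have hSfin : ∀ k, IsFiniteMeasure (volume.restrict (S k)) := fun k =>
    isFiniteMeasure_restrict.2 ((measure_mono (hSΩ k)).trans_lt hΩb.measure_lt_top).ne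
  have hfS : ∀ k, IntegrableOn (fun x => f (v k x)) (S k) := fun k =>
    IntegrableOn.mono_set (hfint k) (hSΩ k)
  have hinfS : ∀ k, IntegrableOn (fun x => finf (v k x)) (S k) := fun k =>
    IntegrableOn.mono_set (hinfint k) (hSΩ k)
  have hinf_eq : ∀ k, ∫ x in Ω, finf (v k x) = ∫ x in S k, finf (v k x) := fun k => by
    have hrestr : volume.restrict (S k) = (volume.restrict Ω).restrict {x | v k x ≠ 0} := by
      rw [Measure.restrict_restrict' hΩo.measurableSet, inter_comm]
      rfl
    rw [hrestr]
    refine (setIntegral_eq_integral_of_forall_compl_eq_zero fun x hx => ?_).symm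
    rw [not_not.1 hx, hinf0]
  have hs : Tendsto (fun k => volume.real (S k)) atTop (𝓝 0) :=
    (ENNReal.tendsto_toReal ENNReal.zero_ne_top).comp hconc
  simp_rw [hinf_eq]
  refine liminf_le_liminf_of_le_one_add_mul (c := K * (1 + K)) (by positivity) hs
    (fun k => integral_nonneg fun x => hinf_nonneg _)
    (fun k => integral_nonneg fun x => hnonneg _) (fun k => ?_) fun ε hε => ?_
  · have hpt : ∀ b, f b ≤ K * (1 + K) * (1 + finf b) := fun b => by
      have h1 : ‖b‖ ≤ K * finf b := (inv_mul_le_iff₀ hK).1 (hlow b)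
      refine (hupper b).trans ?_
      rw [mul_assoc]
      refine mul_le_mul_of_nonneg_left ?_ hK.le
      nlinarith [hinf_nonneg b]
    calc ∫ x in S k, f (v k x)
        ≤ ∫ x in S k, K * (1 + K) * (1 + finf (v k x)) :=
          integral_mono (hfS k) (((integrable_const _).add (hinfS k)).const_mul _)
            fun x => hpt _
      _ = K * (1 + K) * (volume.real (S k) + ∫ x in S k, finf (v k x)) := by
          rw [integral_const_mul, integral_add (integrable_const _) (hinfS k), setIntegral_const,
            smul_eq_mul, mul_one]
  · obtain ⟨C, hC⟩ := recession_le_add_mul_norm hK hconv hnonneg hupper hlim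
      (div_pos hε hK)
    refine ⟨C, fun k => ?_⟩
    have hpt : ∀ b, finf b ≤ (1 + ε) * f b + C := fun b => by
      have h1 : ‖b‖ ≤ K * f b := (inv_mul_le_iff₀ hK).1 (hlower b)
      have h2 : ε / K * ‖b‖ ≤ ε * f b := by
        rw [div_mul_eq_mul_div, div_le_iff₀ hK]
        nlinarith
      linarith [hC b]
    calc ∫ x in S k, finf (v k x)
        ≤ ∫ x in S k, ((1 + ε) * f (v k x) + C) :=
          integral_mono (hinfS k) (((hfS k).const_mul _).add (integrable_const _))
            fun x => hpt _
      _ = (1 + ε) * (∫ x in S k, f (v k x)) + C * volume.real (S k) := by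
          rw [integral_add ((hfS k).const_mul _) (integrable_const _), integral_const_mul,
            setIntegral_const, smul_eq_mul, mul_comm C]
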